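/- Let (Ω,Σ,μ) be a complete finite measure space and X a Banach space with dens(X) < κ(μ). Let φ: X × Ω → ℝ be Lipschitz in x on a neighborhood U of x̄ for every ω ∈ Ω with a μ-integrable Lipschitz modulus uniform on U, and let φ(x,·) be measurable for every x ∈ U. Then the generalized gradient mapping ω ↦ ∂°φ(x̄,ω) is w*-scalarly measurable; equivalently, ω ↦ φ°(x̄,ω;h) is measurable for every h ∈ X. -/

import Mathlib

open MeasureTheory Filter Topology Metric Set Pointwise
open scoped NNReal ENNReal

noncomputable section

universe u v

namespace Paper

section Defs

variable {X : Type u} [NormedAddCommGroup X] [NormedSpace ℝ X]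
variable {Ω : Type v} [MeasurableSpace Ω]

/-- The identity map from the (strong) dual to the dual endowed with the weak* topology. -/
def wstar : (X →L[ℝ] ℝ) → WeakDual ℝ X := fun φ => φ

/-- Support function `s(x,C)` of a set `C ⊆ X*`. -/
def supp (x : X) (C : Set (X →L[ℝ] ℝ)) : ℝ :=
  sSup ((fun φ : X →L[ℝ] ℝ => φ x) '' C)

/-- `f` is Gelfand integrable: all scalarizations are integrable and the scalar
integrals are represented by a continuous linear functional. -/
def GelfandIntegrable (μ : Measure Ω) (f : Ω → X →L[ℝ] ℝ) : Prop :=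
  (∀ x : X, Integrable (fun ω => f ω x) μ) ∧
    ∃ g : X →L[ℝ] ℝ, ∀ x : X, g x = ∫ ω, f ω x ∂μ

/-- The set `S¹_Γ` of Gelfand-integrable a.e. selectors of `Γ`. -/
def selectors (μ : Measure Ω) (Γ : Ω → Set (X →L[ℝ] ℝ)) : Set (Ω → X →L[ℝ] ℝ) :=
  { f | GelfandIntegrable μ f ∧ ∀ᵐ ω ∂μ, f ω ∈ Γ ω }

/-- The Gelfand integral `I(Γ) = { ∫ f dμ : f ∈ S¹_Γ }` of a multifunction. -/
def gelfandIntegral (μ : Measure Ω) (Γ : Ω → Set (X →L[ℝ] ℝ)) : Set (X →L[ℝ] ℝ) :=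
  { g | ∃ f ∈ selectors μ Γ, ∀ x : X, g x = ∫ ω, f ω x ∂μ }

/-- The set `S^{1,w*}_Γ` of Gelfand-integrable w*-almost selectors of `Γ`. -/
def almostSelectors (μ : Measure Ω) (Γ : Ω → Set (X →L[ℝ] ℝ)) : Set (Ω → X →L[ℝ] ℝ) :=
  { f | GelfandIntegrable μ f ∧ ∀ x : X, ∀ᵐ ω ∂μ, f ω x ≤ supp x (Γ ω) }

/-- `Γ` is w*-scalarly measurable. -/
def WScalarlyMeasurable (Γ : Ω → Set (X →L[ℝ] ℝ)) : Prop :=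
  ∀ x : X, Measurable fun ω => supp x (Γ ω)

/-- `Γ` is w*-scalarly integrable. -/
def WScalarlyIntegrable (μ : Measure Ω) (Γ : Ω → Set (X →L[ℝ] ℝ)) : Prop :=
  ∀ x : X, Integrable (fun ω => supp x (Γ ω)) μ

/-- `Γ` is integrably bounded. -/
def IntegrablyBounded (μ : Measure Ω) (Γ : Ω → Set (X →L[ℝ] ℝ)) : Prop :=
  ∃ ψ : Ω → ℝ, Integrable ψ μ ∧ ∀ ω : Ω, ∀ φ ∈ Γ ω, ‖φ‖ ≤ ψ ω

/-- `C ⊆ X*` is weak*-closed. -/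
def WStarClosed (C : Set (X →L[ℝ] ℝ)) : Prop := IsClosed (wstar '' C)

/-- `C ⊆ X*` is weak*-compact. -/
def WStarCompact (C : Set (X →L[ℝ] ℝ)) : Prop := IsCompact (wstar '' C)

/-- Weak*-closure of `C ⊆ X*`. -/
def wstarClosure (C : Set (X →L[ℝ] ℝ)) : Set (X →L[ℝ] ℝ) :=
  wstar ⁻¹' closure (wstar '' C)

/-- Weak*-closed convex hull of `C ⊆ X*`. -/
def wstarClosedConvexHull (C : Set (X →L[ℝ] ℝ)) : Set (X →L[ℝ] ℝ) :=
  wstar ⁻¹' closure (convexHull ℝ (wstar '' C))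

/-- `Y` is an Asplund space: every continuous convex real function on an open convex
set is Fréchet differentiable on a dense subset of that set. -/
def Asplund (Y : Type*) [NormedAddCommGroup Y] [NormedSpace ℝ Y] : Prop :=
  ∀ U : Set Y, IsOpen U → Convex ℝ U →
    ∀ f : Y → ℝ, ContinuousOn f U → ConvexOn ℝ U f →
      U ⊆ closure { y | y ∈ U ∧ ∃ f' : Y →L[ℝ] ℝ, HasFDerivWithinAt f f' U y }

/-- `μ` is a nonatomic measure. -/
def Nonatomic (μ : Measure Ω) : Prop :=
  ∀ A : Set Ω, MeasurableSet A → 0 < μ A →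
    ∃ B : Set Ω, MeasurableSet B ∧ B ⊆ A ∧ 0 < μ B ∧ μ B < μ A

/-- `μ` is a saturated measure: `L¹` of every positive-measure restriction is nonseparable. -/
def Saturated (μ : Measure Ω) : Prop :=
  ∀ E : Set Ω, MeasurableSet E → 0 < μ E →
    ¬ TopologicalSpace.SeparableSpace (Lp ℝ 1 (μ.restrict E))

/-- `dens(Y)`: smallest cardinality of a dense subset of the open unit ball of `Y`. -/
def densCard (Y : Type u) [NormedAddCommGroup Y] : Cardinal.{u} :=
  sInf { c : Cardinal.{u} |
    ∃ D : Set Y, D ⊆ ball (0 : Y) 1 ∧ ball (0 : Y) 1 ⊆ closure D ∧ Cardinal.mk ↥D = c }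

/-- `dens(Y) < κ(μ)`: every family of `μ`-null measurable sets of cardinality at most
`dens(Y)` has measurable union. -/
def DensLtAdditivity (Y : Type u) [NormedAddCommGroup Y] (μ : Measure Ω) : Prop :=
  ∀ 𝒞 : Set (Set Ω), (∀ A ∈ 𝒞, MeasurableSet A ∧ μ A = 0) →
    Cardinal.lift.{u} (Cardinal.mk ↥𝒞) ≤ Cardinal.lift.{v} (densCard Y) →
    MeasurableSet (⋃₀ 𝒞)

/-- Clarke generalized directional derivative `ψ°(x̄;h)`. -/
def clarkeDD (ψ : X → ℝ) (xbar h : X) : ℝ :=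
  limsup (fun p : X × ℝ => (ψ (p.1 + p.2 • h) - ψ p.1) / p.2) ((𝓝 xbar) ×ˢ (𝓝[>] (0 : ℝ)))

/-- Clarke generalized gradient `∂°ψ(x̄)`. -/
def clarkeSubdiff (ψ : X → ℝ) (xbar : X) : Set (X →L[ℝ] ℝ) :=
  { φ | ∀ h : X, φ h ≤ clarkeDD ψ xbar h }

/-- `ψ` is (Clarke) regular at `x̄`: the directional derivative exists and equals `ψ°`. -/
def ClarkeRegularAt (ψ : X → ℝ) (xbar : X) : Prop :=
  ∀ h : X, Tendsto (fun θ : ℝ => (ψ (xbar + θ • h) - ψ xbar) / θ) (𝓝[>] (0 : ℝ))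
    (𝓝 (clarkeDD ψ xbar h))

/-- Limiting (Mordukhovich) subdifferential `∂ψ(x̄)`. -/
def limitingSubdiff (ψ : X → ℝ) (xbar : X) : Set (X →L[ℝ] ℝ) :=
  { p | ∃ (xk : ℕ → X) (pk : ℕ → X →L[ℝ] ℝ),
      Tendsto xk atTop (𝓝 xbar) ∧
      (∀ z : X, Tendsto (fun k => pk k z) atTop (𝓝 (p z))) ∧
      ∀ k : ℕ, 0 ≤ liminf
        (fun y => (ψ y - ψ (xk k) - pk k (y - xk k)) / ‖y - xk k‖) (𝓝[≠] (xk k)) }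

/-- Clarke generalized normal cone `N°(z̄;C)`. -/
def clarkeNormalCone (C : Set X) (zbar : X) : Set (X →L[ℝ] ℝ) :=
  wstarClosure (⋃ α ∈ Ioi (0 : ℝ), α • clarkeSubdiff (fun z => infDist z C) zbar)

/-- Limiting normal cone `N(z̄;C)`. -/
def limitingNormalCone (C : Set X) (zbar : X) : Set (X →L[ℝ] ℝ) :=
  ⋃ α ∈ Ioi (0 : ℝ), α • limitingSubdiff (fun z => infDist z C) zbar

/-- A multifunction is lower semicontinuous. -/
def LowerSC {Y : Type*} [TopologicalSpace Y] {Z : Type*} [TopologicalSpace Z]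
    (F : Y → Set Z) : Prop :=
  ∀ U : Set Z, IsOpen U → IsOpen { y | (F y ∩ U).Nonempty }

/-- A multifunction is upper semicontinuous. -/
def UpperSC {Y : Type*} [TopologicalSpace Y] {Z : Type*} [TopologicalSpace Z]
    (F : Y → Set Z) : Prop :=
  ∀ U : Set Z, IsOpen U → IsOpen { y | F y ⊆ U }

/-- `P` is a stochastic kernel (transition probability). -/
def StochasticKernel (P : Ω → Measure Ω) : Prop :=
  (∀ ω, IsProbabilityMeasure (P ω)) ∧
    ∀ A : Set Ω, MeasurableSet A → Measurable fun ω => P ω A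

/-- `v` is a bounded Carathéodory solution of the Bellman equation, the minimum
over `Γ x ω` being attained. -/
def BellmanSolution (P : Ω → Measure Ω) (β : ℝ) (u : X → X → Ω → ℝ)
    (Γ : X → Ω → Set X) (v : X → Ω → ℝ) : Prop :=
  (∃ M : ℝ, ∀ x ω, |v x ω| ≤ M) ∧
  (∀ ω, Continuous fun x => v x ω) ∧
  (∀ x, Measurable fun ω => v x ω) ∧
  ∀ x ω,
    (∃ y ∈ Γ x ω, v x ω = u x y ω + β * ∫ ω', v y ω' ∂(P ω)) ∧
    ∀ y ∈ Γ x ω, v x ω ≤ u x y ω + β * ∫ ω', v y ω' ∂(P ω)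

/-- The policy multifunction `G(x,ω)` associated with a Bellman solution `v`. -/
def policyMap (P : Ω → Measure Ω) (β : ℝ) (u : X → X → Ω → ℝ)
    (Γ : X → Ω → Set X) (v : X → Ω → ℝ) (x : X) (ω : Ω) : Set X :=
  { y ∈ Γ x ω | v x ω = u x y ω + β * ∫ ω', v y ω' ∂(P ω) }

/-- Standing assumptions (H1), (H2) on the stochastic DP problem. -/
def DPStandingAssumptions [MeasurableSpace X] (P : Ω → Measure Ω) (β : ℝ)
    (u : X → X → Ω → ℝ) (Γ : X → Ω → Set X) : Prop :=
  StochasticKernel P ∧ 0 ≤ β ∧ β < 1 ∧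
  (∃ M : ℝ, ∀ x y ω, |u x y ω| ≤ M) ∧
  (∀ ω, Continuous fun p : X × X => u p.1 p.2 ω) ∧
  (∀ x y, Measurable fun ω => u x y ω) ∧
  (∀ x ω, (Γ x ω).Nonempty ∧ IsCompact (Γ x ω)) ∧
  (∀ U : Set X, IsOpen U → MeasurableSet { p : X × Ω | (Γ p.1 p.2 ∩ U).Nonempty }) ∧
  (∀ ω, LowerSC (fun x => Γ x ω) ∧ UpperSC (fun x => Γ x ω)) ∧
  (∀ x, ∀ U : Set X, IsOpen U → MeasurableSet { ω | (Γ x ω ∩ U).Nonempty })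

/-- `G` is locally lower viable around `x̄` (relative to `Γ`). -/
def LocLowerViable (G Γ : X → Ω → Set X) (xbar : X) : Prop :=
  ∀ ω, ∃ U ∈ 𝓝 xbar, ∀ x ∈ U, ∀ x' ∈ U, (G x ω ∩ Γ x' ω).Nonempty

/-- `G` is locally upper viable around `x̄` (relative to `Γ`). -/
def LocUpperViable (G Γ : X → Ω → Set X) (xbar : X) : Prop :=
  ∀ ω, ∃ U ∈ 𝓝 xbar, ∀ x ∈ U, ∀ x' ∈ U, G x ω ⊆ Γ x' ω

end Defs

section Measurability

variable {Ω : Type v} [MeasurableSpace Ω]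

/-- In a finite measure space, a family of measurable sets has measurable union as soon as every
family of null measurable sets with the same index type does. -/
theorem measurableSet_iUnion_of_null {μ : Measure Ω} [IsFiniteMeasure μ] {ι : Type*}
    (hnull : ∀ N : ι → Set Ω, (∀ i, MeasurableSet (N i) ∧ μ (N i) = 0) → MeasurableSet (⋃ i, N i))
    {E : ι → Set Ω} (hE : ∀ i, MeasurableSet (E i)) : MeasurableSet (⋃ i, E i) := by
  let S : Set ℝ≥0∞ := (fun J : Set ι => μ (⋃ i ∈ J, E i)) '' {J | J.Countable}
  have hS : S.Nonempty := ⟨_, ∅, countable_empty, rfl⟩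
  obtain ⟨u, -, hu, huS⟩ := exists_seq_tendsto_sSup hS (OrderTop.bddAbove S)
  choose J hJ hJu using huS
  have hcount : (⋃ n, J n).Countable := countable_iUnion hJ
  have hmax : sSup S ≤ μ (⋃ i ∈ ⋃ n, J n, E i) :=
    le_of_tendsto' hu fun n =>
      (hJu n).ge.trans (measure_mono (biUnion_subset_biUnion_left (subset_iUnion J n)))
  have hmeasA : MeasurableSet (⋃ i ∈ ⋃ n, J n, E i) :=
    MeasurableSet.biUnion hcount fun i _ => hE i
  generalize ⋃ n, J n = A at hcount hmax hmeasA
  have hdiff (i : ι) : μ (E i \ ⋃ i ∈ A, E i) = 0 := by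
    have hle : μ (⋃ j ∈ insert i A, E j) ≤ μ (⋃ j ∈ A, E j) :=
      (le_sSup (s := S) ⟨insert i A, hcount.insert i, rfl⟩).trans hmax
    rw [biUnion_insert, ← sdiff_union_self,
      measure_union disjoint_sdiff_left hmeasA] at hle
    have hfin : μ (⋃ j ∈ A, E j) ≠ ∞ := measure_ne_top _ _
    exact nonpos_iff_eq_zero.1 ((ENNReal.add_le_add_iff_right hfin).1 (by simpa using hle))
  have heq : ⋃ i, E i = (⋃ i ∈ A, E i) ∪ ⋃ i, E i \ ⋃ i ∈ A, E i := by
    rw [← iUnion_sdiff, union_sdiff_self, union_eq_self_of_subset_left]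
    exact iUnion₂_subset fun i _ => subset_iUnion E i
  rw [heq]
  exact hmeasA.union (hnull _ fun i => ⟨(hE i).diff hmeasA, hdiff i⟩)

/-- The density character of `Y` is attained by a dense subset of the open unit ball. -/
theorem exists_mk_eq_densCard (Y : Type u) [NormedAddCommGroup Y] :
    ∃ D : Set Y, D ⊆ ball (0 : Y) 1 ∧ ball (0 : Y) 1 ⊆ closure D ∧ Cardinal.mk ↥D = densCard Y :=
  csInf_mem (s := { c : Cardinal.{u} |
    ∃ D : Set Y, D ⊆ ball (0 : Y) 1 ∧ ball (0 : Y) 1 ⊆ closure D ∧ Cardinal.mk ↥D = c })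
    ⟨_, ball (0 : Y) 1, Subset.rfl, subset_closure, rfl⟩

theorem DensLtAdditivity.measurableSet_iUnion {Y : Type u} [NormedAddCommGroup Y] {μ : Measure Ω}
    [IsFiniteMeasure μ] (h : DensLtAdditivity Y μ) {D : Set Y} (hD : Cardinal.mk ↥D = densCard Y)
    {E : D → Set Ω} (hE : ∀ d, MeasurableSet (E d)) : MeasurableSet (⋃ d, E d) := by
  refine measurableSet_iUnion_of_null (μ := μ) (fun N hN => ?_) hE
  rw [← sUnion_range]
  refine h _ (by rintro _ ⟨d, rfl⟩; exact hN d) ?_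
  rw [← hD]
  exact Cardinal.mk_range_le_lift

end Measurability

section ClarkeDerivative

variable {X : Type u} [NormedAddCommGroup X] [NormedSpace ℝ X]

/-- The difference quotient of `ψ` in the direction `h`, at base point `p.1` and step `p.2`. -/
def diffQuot (ψ : X → ℝ) (h : X) (p : X × ℝ) : ℝ := (ψ (p.1 + p.2 • h) - ψ p.1) / p.2

theorem clarkeDD_eq_limsup (ψ : X → ℝ) (xbar h : X) :
    clarkeDD ψ xbar h = limsup (diffQuot ψ h) (𝓝 xbar ×ˢ 𝓝[>] 0) := rfl

theorem tendsto_add_smul_nhds (xbar h : X) :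
    Tendsto (fun p : X × ℝ => p.1 + p.2 • h) (𝓝 xbar ×ˢ 𝓝[>] 0) (𝓝 xbar) := by
  have hc : Continuous fun p : X × ℝ => p.1 + p.2 • h := by fun_prop
  have := hc.tendsto (xbar, 0)
  simp only [zero_smul, add_zero, nhds_prod_eq] at this
  exact this.mono_left (prod_mono le_rfl nhdsWithin_le_nhds)

theorem eventually_snd_pos {X : Type*} [TopologicalSpace X] (xbar : X) :
    ∀ᶠ p : X × ℝ in 𝓝 xbar ×ˢ 𝓝[>] 0, 0 < p.2 :=
  tendsto_snd.eventually self_mem_nhdsWithin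

variable {ψ : X → ℝ} {xbar : X} {U : Set X} {K : ℝ}

theorem eventually_abs_diffQuot_le (hU : U ∈ 𝓝 xbar)
    (hψ : ∀ x ∈ U, ∀ x' ∈ U, |ψ x - ψ x'| ≤ K * ‖x - x'‖) (h : X) :
    ∀ᶠ p in 𝓝 xbar ×ˢ 𝓝[>] 0, |diffQuot ψ h p| ≤ K * ‖h‖ := by
  filter_upwards [tendsto_fst.eventually hU, (tendsto_add_smul_nhds xbar h).eventually hU,
    eventually_snd_pos xbar] with p hp₁ hp₂ hp₃
  rw [diffQuot, abs_div, abs_of_pos hp₃, div_le_iff₀ hp₃]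
  refine (hψ _ hp₂ _ hp₁).trans_eq ?_
  rw [add_sub_cancel_left, norm_smul, Real.norm_of_nonneg hp₃.le]
  ring

theorem eventually_diffQuot_lt (hU : U ∈ 𝓝 xbar)
    (hψ : ∀ x ∈ U, ∀ x' ∈ U, |ψ x - ψ x'| ≤ K * ‖x - x'‖) {h : X} {b : ℝ}
    (hb : clarkeDD ψ xbar h < b) : ∀ᶠ p in 𝓝 xbar ×ˢ 𝓝[>] 0, diffQuot ψ h p < b :=
  eventually_lt_of_limsup_lt hb
    (isBoundedUnder_of_eventually_le
      ((eventually_abs_diffQuot_le hU hψ h).mono fun _ hp => (abs_le.1 hp).2))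

theorem clarkeDD_le_of_eventually (hU : U ∈ 𝓝 xbar)
    (hψ : ∀ x ∈ U, ∀ x' ∈ U, |ψ x - ψ x'| ≤ K * ‖x - x'‖) {h : X} {b : ℝ}
    (hb : ∀ᶠ p in 𝓝 xbar ×ˢ 𝓝[>] 0, diffQuot ψ h p ≤ b) : clarkeDD ψ xbar h ≤ b :=
  limsup_le_of_le
    (isBoundedUnder_of_eventually_ge
      ((eventually_abs_diffQuot_le hU hψ h).mono fun _ hp => (abs_le.1 hp).1)).isCoboundedUnder_le
    hb

theorem clarkeDD_le_mul_norm (hU : U ∈ 𝓝 xbar)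
    (hψ : ∀ x ∈ U, ∀ x' ∈ U, |ψ x - ψ x'| ≤ K * ‖x - x'‖) (h : X) :
    clarkeDD ψ xbar h ≤ K * ‖h‖ :=
  clarkeDD_le_of_eventually hU hψ
    ((eventually_abs_diffQuot_le hU hψ h).mono fun _ hp => (abs_le.1 hp).2)

theorem clarkeDD_zero (ψ : X → ℝ) (xbar : X) : clarkeDD ψ xbar 0 = 0 := by
  simp [clarkeDD]

theorem clarkeDD_smul_le (hU : U ∈ 𝓝 xbar)
    (hψ : ∀ x ∈ U, ∀ x' ∈ U, |ψ x - ψ x'| ≤ K * ‖x - x'‖) {c : ℝ} (hc : 0 < c) (h : X) :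
    clarkeDD ψ xbar (c • h) ≤ c * clarkeDD ψ xbar h := by
  rw [← div_le_iff₀' hc]
  refine le_of_forall_gt_imp_ge_of_dense fun b hb => ?_
  rw [div_le_iff₀' hc]
  have hscale : Tendsto (fun θ : ℝ => θ * c) (𝓝[>] 0) (𝓝[>] 0) := by
    refine tendsto_nhdsWithin_iff.2 ⟨?_, ?_⟩
    · have : Tendsto (fun θ : ℝ => θ * c) (𝓝 0) (𝓝 (0 * c)) := tendsto_id.mul_const c
      rw [zero_mul] at this
      exact this.mono_left nhdsWithin_le_nhds
    · filter_upwards [self_mem_nhdsWithin] with θ hθ using mul_pos hθ hc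
  refine clarkeDD_le_of_eventually hU hψ ?_
  filter_upwards [(tendsto_id.prodMap hscale).eventually (eventually_diffQuot_lt hU hψ hb),
    eventually_snd_pos xbar] with p hp hp₀
  simp only [diffQuot, Prod.map, id, mul_smul, div_lt_iff₀ (mul_pos hp₀ hc)] at hp
  rw [diffQuot, div_le_iff₀ hp₀]
  linarith

theorem clarkeDD_smul (hU : U ∈ 𝓝 xbar)
    (hψ : ∀ x ∈ U, ∀ x' ∈ U, |ψ x - ψ x'| ≤ K * ‖x - x'‖) {c : ℝ} (hc : 0 < c) (h : X) :
    clarkeDD ψ xbar (c • h) = c * clarkeDD ψ xbar h := by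
  refine (clarkeDD_smul_le hU hψ hc h).antisymm ?_
  have := clarkeDD_smul_le hU hψ (inv_pos.2 hc) (c • h)
  rwa [inv_smul_smul₀ hc.ne', le_inv_mul_iff₀ hc] at this

theorem clarkeDD_add_le (hU : U ∈ 𝓝 xbar)
    (hψ : ∀ x ∈ U, ∀ x' ∈ U, |ψ x - ψ x'| ≤ K * ‖x - x'‖) (h₁ h₂ : X) :
    clarkeDD ψ xbar (h₁ + h₂) ≤ clarkeDD ψ xbar h₁ + clarkeDD ψ xbar h₂ := by
  refine le_of_forall_pos_le_add fun ε hε => ?_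
  refine clarkeDD_le_of_eventually hU hψ ?_
  have hshift : Tendsto (fun p : X × ℝ => (p.1 + p.2 • h₂, p.2)) (𝓝 xbar ×ˢ 𝓝[>] 0)
      (𝓝 xbar ×ˢ 𝓝[>] 0) := (tendsto_add_smul_nhds xbar h₂).prodMk tendsto_snd
  filter_upwards [hshift.eventually (eventually_diffQuot_lt hU hψ
      (lt_add_of_pos_right (clarkeDD ψ xbar h₁) (half_pos hε))),
    eventually_diffQuot_lt hU hψ (lt_add_of_pos_right (clarkeDD ψ xbar h₂) (half_pos hε))]
    with p hp₁ hp₂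
  have hsplit : diffQuot ψ (h₁ + h₂) p
      = diffQuot ψ h₁ (p.1 + p.2 • h₂, p.2) + diffQuot ψ h₂ p := by
    simp only [diffQuot, smul_add]
    rw [← add_div, sub_add_sub_cancel, add_assoc, add_comm (p.2 • h₁)]
  linarith

/-- The support function of the generalized gradient is the generalized directional derivative. -/
theorem supp_clarkeSubdiff (hU : U ∈ 𝓝 xbar)
    (hψ : ∀ x ∈ U, ∀ x' ∈ U, |ψ x - ψ x'| ≤ K * ‖x - x'‖) (z : X) :
    supp z (clarkeSubdiff ψ xbar) = clarkeDD ψ xbar z := by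
  have hz : ∀ c : ℝ, c • z = 0 → RingHom.id ℝ c • clarkeDD ψ xbar z = 0 := by
    intro c hc
    rcases smul_eq_zero.1 hc with rfl | rfl
    · simp
    · simp [clarkeDD_zero]
  obtain ⟨g, hgz, hg⟩ := exists_extension_of_le_sublinear
    (LinearPMap.mkSpanSingleton' z (clarkeDD ψ xbar z) hz) (clarkeDD ψ xbar)
    (fun c hc x => clarkeDD_smul hU hψ hc x) (clarkeDD_add_le hU hψ) (by
      rintro ⟨x, hx⟩
      obtain ⟨c, rfl⟩ := Submodule.mem_span_singleton.1 hx
      rw [LinearPMap.mkSpanSingleton'_apply]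
      simp only [RingHom.id_apply, smul_eq_mul]
      rcases lt_trichotomy c 0 with hc | rfl | hc
      · have hsum := clarkeDD_add_le hU hψ (c • z) ((-c) • z)
        rw [← add_smul, add_neg_cancel, zero_smul, clarkeDD_zero,
          clarkeDD_smul hU hψ (neg_pos.2 hc)] at hsum
        linarith
      · simp [clarkeDD_zero]
      · exact (clarkeDD_smul hU hψ hc z).ge)
  have hbound (x : X) : ‖g x‖ ≤ K * ‖x‖ := by
    rw [Real.norm_eq_abs, abs_le']
    refine ⟨(hg x).trans (clarkeDD_le_mul_norm hU hψ x), ?_⟩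
    rw [← map_neg, ← norm_neg x]
    exact (hg (-x)).trans (clarkeDD_le_mul_norm hU hψ (-x))
  have hgz' : g z = clarkeDD ψ xbar z :=
    (hgz ⟨z, Submodule.mem_span_singleton_self z⟩).trans
      (LinearPMap.mkSpanSingleton'_apply_self _ _ _ _)
  refine IsGreatest.csSup_eq ⟨⟨g.mkContinuous K hbound, fun x => hg x, hgz'⟩, ?_⟩
  rintro _ ⟨f, hf, rfl⟩
  exact hf z

theorem eventually_nhds_prod_nhdsGT_iff {δ : ℝ} (hδ : 0 < δ) {P : X × ℝ → Prop} :
    (∀ᶠ p in 𝓝 xbar ×ˢ 𝓝[>] 0, P p) ↔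
      ∃ n : ℕ, ∀ q ∈ ball (0 : X) 1 ×ˢ Ioo 0 (δ / (n + 1)),
        P (xbar + (δ / (n + 1)) • q.1, q.2) := by
  constructor
  · intro h
    obtain ⟨⟨ε, ε'⟩, ⟨hε, hε'⟩, hP⟩ :=
      (nhds_basis_ball.prod (nhdsGT_basis (0 : ℝ))).eventually_iff.1 h
    obtain ⟨n, hn⟩ := exists_nat_one_div_lt (div_pos (lt_min hε hε') hδ)
    have hn' : δ / (n + 1) < min ε ε' := by
      rw [lt_div_iff₀ hδ] at hn
      rwa [div_eq_mul_one_div, mul_comm]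
    refine ⟨n, fun q hq => hP ⟨?_, hq.2.1, hq.2.2.trans (hn'.trans_le (min_le_right _ _))⟩⟩
    have hpos : 0 < δ / (n + 1) := by positivity
    have hq₁ : ‖q.1‖ < 1 := mem_ball_zero_iff.1 hq.1
    rw [mem_ball_iff_norm, add_sub_cancel_left, norm_smul, Real.norm_of_nonneg hpos.le]
    exact (mul_lt_of_lt_one_right hpos hq₁).trans (hn'.trans_le (min_le_left _ _))
  · rintro ⟨n, hn⟩
    have hpos : 0 < δ / (n + 1) := by positivity
    filter_upwards [prod_mem_prod (ball_mem_nhds xbar hpos) (Ioo_mem_nhdsGT hpos)] with p hp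
    have := hn ((δ / (n + 1))⁻¹ • (p.1 - xbar), p.2) ⟨?_, hp.2⟩
    · simpa only [smul_inv_smul₀ hpos.ne', add_sub_cancel] using this
    · rw [mem_ball_zero_iff, norm_smul, norm_inv, Real.norm_of_nonneg hpos.le,
        inv_mul_lt_one₀ hpos]
      exact mem_ball_iff_norm.1 hp.1

end ClarkeDerivative

/-- A bound for a function continuous on `s` may be checked on a dense subset of `s`. -/
theorem forall_le_iff_of_subset_closure {Y : Type*} [TopologicalSpace Y] {f : Y → ℝ} {s t : Set Y}
    (hf : ContinuousOn f s) (hts : t ⊆ s) (hst : s ⊆ closure t) {b : ℝ} :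
    (∀ y ∈ s, f y ≤ b) ↔ ∀ y ∈ t, f y ≤ b := by
  refine ⟨fun h y hy => h y (hts hy), fun h y hy => ?_⟩
  have : (𝓝[t] y).NeBot := mem_closure_iff_nhdsWithin_neBot.1 (hst hy)
  exact le_of_tendsto ((hf y hy).mono hts) (eventually_mem_nhdsWithin.mono h)

theorem measurable_clarkeDD
    {X : Type u} [NormedAddCommGroup X] [NormedSpace ℝ X]
    {Ω : Type v} [MeasurableSpace Ω] {μ : Measure Ω} [IsFiniteMeasure μ]
    (hdens : DensLtAdditivity X μ)
    {φ : X → Ω → ℝ} {xbar : X} {U : Set X} (hU : U ∈ 𝓝 xbar) {l : Ω → ℝ}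
    (hLip : ∀ ω, ∀ x ∈ U, ∀ x' ∈ U, |φ x ω - φ x' ω| ≤ l ω * ‖x - x'‖)
    (hmeas : ∀ x ∈ U, Measurable fun ω => φ x ω) (h : X) :
    Measurable fun ω => clarkeDD (fun x => φ x ω) xbar h := by
  obtain ⟨r, hr, hrU⟩ := Metric.mem_nhds_iff.1 hU
  obtain ⟨D, hD, hDdense, hDcard⟩ := exists_mk_eq_densCard X
  have hh : 0 < 1 + ‖h‖ := by positivity
  set δ : ℝ := r / (1 + ‖h‖) with hδ_def
  have hδ : 0 < δ := div_pos hr hh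
  have hmem {n : ℕ} {q : X × ℝ} (hq : q ∈ ball (0 : X) 1 ×ˢ Ioo 0 (δ / (n + 1))) :
      xbar + (δ / (n + 1)) • q.1 ∈ U ∧ xbar + (δ / (n + 1)) • q.1 + q.2 • h ∈ U := by
    have hpos : 0 < δ / (n + 1) := by positivity
    have hle : δ / (n + 1) ≤ δ := div_le_self hδ.le (by simp)
    have hq₁ : ‖q.1‖ < 1 := mem_ball_zero_iff.1 hq.1
    have hδr : δ + δ * ‖h‖ = r := by
      rw [hδ_def]; field_simp
    have h₁ : ‖(δ / (n + 1)) • q.1‖ < δ := by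
      rw [norm_smul, Real.norm_of_nonneg hpos.le]
      exact (mul_lt_of_lt_one_right hpos hq₁).trans_le hle
    have h₂ : ‖q.2 • h‖ ≤ δ * ‖h‖ := by
      rw [norm_smul, Real.norm_of_nonneg hq.2.1.le]
      exact mul_le_mul_of_nonneg_right (hq.2.2.le.trans hle) (norm_nonneg h)
    refine ⟨hrU ?_, hrU ?_⟩
    · rw [mem_ball_iff_norm, add_sub_cancel_left]
      nlinarith [norm_nonneg h]
    · rw [mem_ball_iff_norm, add_assoc, add_sub_cancel_left]
      exact (norm_add_le _ _).trans_lt (by linarith)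
  let Q (n : ℕ) (ω : Ω) (q : X × ℝ) : ℝ :=
    diffQuot (fun x => φ x ω) h (xbar + (δ / (n + 1)) • q.1, q.2)
  have hcontU (ω : Ω) : ContinuousOn (fun x => φ x ω) U := by
    refine (LipschitzOnWith.of_dist_le_mul (K := (l ω).toNNReal) fun x hx y hy => ?_).continuousOn
    rw [Real.dist_eq, dist_eq_norm]
    exact (hLip ω x hx y hy).trans
      (mul_le_mul_of_nonneg_right (Real.le_coe_toNNReal _) (norm_nonneg _))
  have hcont (n : ℕ) (ω : Ω) :
      ContinuousOn (Q n ω) (ball (0 : X) 1 ×ˢ Ioo 0 (δ / (n + 1))) := by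
    refine ContinuousOn.div (ContinuousOn.sub ?_ ?_) (by fun_prop) fun q hq => hq.2.1.ne'
    · exact (hcontU ω).comp (by fun_prop) fun q hq => (hmem hq).2
    · exact (hcontU ω).comp (by fun_prop) fun q hq => (hmem hq).1
  have hQmeas {n : ℕ} {q : X × ℝ} (hq : q ∈ ball (0 : X) 1 ×ˢ Ioo 0 (δ / (n + 1))) :
      Measurable fun ω => Q n ω q :=
    ((hmeas _ (hmem hq).2).sub (hmeas _ (hmem hq).1)).div_const _
  have hset (n : ℕ) (b : ℝ) :
      MeasurableSet {ω | ∀ q ∈ ball (0 : X) 1 ×ˢ Ioo 0 (δ / (n + 1)), Q n ω q ≤ b} := by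
    let T : Set ℝ := Ioo 0 (δ / (n + 1)) ∩ range ((↑) : ℚ → ℝ)
    have hT : T.Countable := (countable_range _).mono inter_subset_right
    have hsub : D ×ˢ T ⊆ ball (0 : X) 1 ×ˢ Ioo 0 (δ / (n + 1)) :=
      prod_mono hD inter_subset_left
    have hdense : ball (0 : X) 1 ×ˢ Ioo 0 (δ / (n + 1)) ⊆ closure (D ×ˢ T) := by
      rw [closure_prod_eq]
      exact prod_mono hDdense (Rat.denseRange_cast.open_subset_closure_inter isOpen_Ioo)
    simp only [forall_le_iff_of_subset_closure (hcont n _) hsub hdense]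
    have hunion : {ω | ∀ q ∈ D ×ˢ T, Q n ω q ≤ b}
        = (⋃ θ ∈ T, ⋃ d : D, {ω | b < Q n ω (d, θ)})ᶜ := by
      ext ω
      simp only [mem_ofPred_eq, mem_compl_iff, mem_iUnion, not_exists, not_lt, Prod.forall,
        mem_prod, Subtype.forall]
      exact ⟨fun H θ hθ d hd => H d θ ⟨hd, hθ⟩, fun H d θ hq => H θ hq.2 d hq.1⟩
    rw [hunion]
    refine (MeasurableSet.biUnion hT fun θ hθ => hdens.measurableSet_iUnion hDcard fun d => ?_).compl
    exact measurableSet_lt measurable_const (hQmeas (hsub ⟨d.2, hθ⟩))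
  refine measurable_of_Iio fun c => ?_
  have hpre : (fun ω => clarkeDD (fun x => φ x ω) xbar h) ⁻¹' Iio c
      = ⋃ b : ℚ, ⋃ _ : (b : ℝ) < c, ⋃ n : ℕ,
        {ω | ∀ q ∈ ball (0 : X) 1 ×ˢ Ioo 0 (δ / (n + 1)), Q n ω q ≤ b} := by
    ext ω
    simp only [mem_preimage, mem_Iio, mem_iUnion, mem_ofPred_eq, exists_prop]
    have hiff (b : ℝ) := eventually_nhds_prod_nhdsGT_iff (xbar := xbar) hδ
      (P := fun p => diffQuot (fun x => φ x ω) h p ≤ b)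
    constructor
    · intro hc
      obtain ⟨b, hb, hbc⟩ := exists_rat_btwn hc
      exact ⟨b, hbc, (hiff b).1 ((eventually_diffQuot_lt hU (hLip ω) hb).mono fun _ hp => hp.le)⟩
    · rintro ⟨b, hbc, hb⟩
      exact (clarkeDD_le_of_eventually hU (hLip ω) ((hiff b).2 hb)).trans_lt hbc
  rw [hpre]
  exact .iUnion fun b => .iUnion fun _ => .iUnion fun n => hset n b

/-- if `dens(X) < κ(μ)`, the generalized directional derivative
`ω ↦ φ°(x̄,ω;h)` is measurable for every direction `h`, i.e. the generalized gradient
mapping `ω ↦ ∂°φ(x̄,ω)` is w*-scalarly measurable. -/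
theorem clarke_gradient_scalarly_measurable
    {X : Type u} [NormedAddCommGroup X] [NormedSpace ℝ X] [CompleteSpace X]
    {Ω : Type v} [MeasurableSpace Ω] (μ : Measure Ω)
    (hcomp : μ.IsComplete) [IsFiniteMeasure μ]
    (hdens : DensLtAdditivity X μ)
    (φ : X → Ω → ℝ) (xbar : X) (U : Set X) (hU : U ∈ 𝓝 xbar)
    (l : Ω → ℝ) (hl : Integrable l μ)
    (hLip : ∀ ω, ∀ x ∈ U, ∀ x' ∈ U, |φ x ω - φ x' ω| ≤ l ω * ‖x - x'‖)
    (hmeas : ∀ x ∈ U, Measurable fun ω => φ x ω) :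
    (∀ h : X, Measurable fun ω => clarkeDD (fun x => φ x ω) xbar h) ∧
    ∀ z : X, Measurable fun ω => supp z (clarkeSubdiff (fun x => φ x ω) xbar) := by
  have hdd := measurable_clarkeDD hdens hU hLip hmeas
  refine ⟨hdd, fun z => ?_⟩
  simpa only [supp_clarkeSubdiff hU (hLip _)] using hdd z

end Paper
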